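/- arXiv:2011.02583 — 2 statements merged into one kernel-verified Lean document; each statement's English description precedes it below -/
import Mathlib

section
/- Let P be an irreducible row-stochastic matrix and s ∈ [0,1]^V. Fix i ∈ V and fix the resistance values α_j ∈ (0,1) for all j ≠ i. Then the function α_i ↦ f(α) is monotone on (0,1): it is either nondecreasing on all of (0,1) or nonincreasing on all of (0,1). Consequently, in minimizing f over a box Π_{i∈V}[l_i, u_i] with 0 < l_i < u_i < 1, it suffices to consider resistance vectors with α_i ∈ {l_i, u_i} for every i ∈ V. -/
open Matrix

/-- Minimum principle for `I - (I - A) P`. -/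
theorem minPrinciple {V : Type*} [Fintype V] [DecidableEq V] [Nonempty V]
    (P : Matrix V V ℝ) (hP0 : ∀ i j, 0 ≤ P i j) (hP1 : ∀ i, ∑ j, P i j = 1)
    (a : V → ℝ) (ha : ∀ j, a j ∈ Set.Ioo (0 : ℝ) 1) (v : V → ℝ)
    (hv : ∀ k, 0 ≤ v k - (1 - a k) * (P *ᵥ v) k) : ∀ k, 0 ≤ v k := by
  obtain ⟨k, hk⟩ := Finite.exists_min v
  have h1 : v k ≤ (P *ᵥ v) k := by
    have : v k = ∑ j, P k j * v k := by rw [← Finset.sum_mul, hP1, one_mul]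
    rw [this, mulVec, dotProduct]
    exact Finset.sum_le_sum fun j _ => mul_le_mul_of_nonneg_left (hk j) (hP0 k j)
  have h2 := hv k
  have h3 := ha k
  have h4 : (1 - a k) * v k ≤ (1 - a k) * (P *ᵥ v) k :=
    mul_le_mul_of_nonneg_left h1 (by linarith [h3.2])
  have h5 : 0 ≤ a k * v k := by linarith
  have h6 : 0 ≤ v k := nonneg_of_mul_nonneg_right h5 h3.1
  exact fun j => h6.trans (hk j)

theorem M_apply {V : Type*} [Fintype V] [DecidableEq V]
    (P : Matrix V V ℝ) (a v : V → ℝ) (k : V) :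
    ((1 - (1 - diagonal a) * P) *ᵥ v) k = v k - (1 - a k) * (P *ᵥ v) k := by
  simp [sub_mulVec, ← mulVec_mulVec, mulVec_diagonal, sub_mul]

theorem M_unit {V : Type*} [Fintype V] [DecidableEq V] [Nonempty V]
    (P : Matrix V V ℝ) (hP0 : ∀ i j, 0 ≤ P i j) (hP1 : ∀ i, ∑ j, P i j = 1)
    (a : V → ℝ) (ha : ∀ j, a j ∈ Set.Ioo (0 : ℝ) 1) :
    IsUnit (1 - (1 - diagonal a) * P) := by
  rw [← mulVec_injective_iff_isUnit]
  intro v w hvw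
  have key : ∀ v w : V → ℝ, (1 - (1 - diagonal a) * P) *ᵥ v = (1 - (1 - diagonal a) * P) *ᵥ w →
      ∀ k, w k ≤ v k := by
    intro v w h k
    have := minPrinciple P hP0 hP1 a ha (v - w) (fun k => by
      rw [← M_apply, mulVec_sub, h, sub_self]; simp) k
    simpa using this
  funext k
  exact le_antisymm (key w v hvw.symm k) (key v w hvw k)

/-- Comparison of two equilibria differing in coordinate `i` only. -/
theorem compare_eq {V : Type*} [Fintype V] [DecidableEq V] [Nonempty V]
    (P : Matrix V V ℝ) (hP0 : ∀ i j, 0 ≤ P i j) (hP1 : ∀ i, ∑ j, P i j = 1)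
    (s : V → ℝ) (i : V) (α : V → ℝ) (hα : ∀ j, j ≠ i → α j ∈ Set.Ioo (0 : ℝ) 1)
    (z : ℝ → V → ℝ)
    (hz : ∀ x, z x = (1 - (1 - diagonal (Function.update α i x)) * P)⁻¹ *ᵥ
      (diagonal (Function.update α i x) *ᵥ s))
    (x y : ℝ) (hx : x ∈ Set.Ioo (0 : ℝ) 1) (hy : y ∈ Set.Ioo (0 : ℝ) 1) :
    ∃ w : V → ℝ, (∀ k, 0 ≤ w k) ∧
      z y = z x + ((y - x) * (s i - (P *ᵥ z x) i)) • w := by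
  have hU : ∀ x ∈ Set.Ioo (0 : ℝ) 1, ∀ j, Function.update α i x j ∈ Set.Ioo (0 : ℝ) 1 := by
    intro x hx j
    by_cases h : j = i
    · subst h; simpa using hx
    · simpa [Function.update_of_ne h] using hα j h
  have hMM : ∀ x ∈ Set.Ioo (0 : ℝ) 1, ∀ b : V → ℝ,
      (1 - (1 - diagonal (Function.update α i x)) * P) *ᵥ
        ((1 - (1 - diagonal (Function.update α i x)) * P)⁻¹ *ᵥ b) = b := by
    intro x hx b
    have := M_unit P hP0 hP1 _ (hU x hx)
    rw [mulVec_mulVec, mul_nonsing_inv _ ((isUnit_iff_isUnit_det _).1 this), one_mulVec]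
  have hzx : ∀ x ∈ Set.Ioo (0 : ℝ) 1, ∀ k, z x k - (1 - Function.update α i x k) * (P *ᵥ z x) k
      = Function.update α i x k * s k := by
    intro x hx k
    rw [← M_apply, hz, hMM x hx, mulVec_diagonal]
  set w := (1 - (1 - diagonal (Function.update α i y)) * P)⁻¹ *ᵥ (Pi.single i 1 : V → ℝ) with hw
  have hwk : ∀ k, w k - (1 - Function.update α i y k) * (P *ᵥ w) k = (Pi.single i 1 : V → ℝ) k := by
    intro k
    rw [← M_apply, hw, hMM y hy]
  refine ⟨w, minPrinciple P hP0 hP1 _ (hU y hy) w fun k => ?_, ?_⟩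
  · rw [hwk, Pi.single_apply]; split_ifs <;> norm_num
  · apply mulVec_injective_iff_isUnit.2 (M_unit P hP0 hP1 _ (hU y hy))
    funext k
    simp only [M_apply]
    rw [hzx y hy, mulVec_add, mulVec_smul]
    simp only [Pi.add_apply, Pi.smul_apply, smul_eq_mul]
    have h1 := hwk k
    have h2 := hzx x hx k
    by_cases h : k = i
    · subst h
      simp only [Function.update_self, Pi.single_eq_same] at *
      linear_combination (-1) * h2 - (y - x) * (s k - (P *ᵥ z x) k) * h1
    · simp only [Function.update_of_ne h, Pi.single_eq_of_ne h] at *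
      linear_combination (-1) * h2 - (y - x) * (s i - (P *ᵥ z x) i) * h1

theorem part_one {V : Type*} [Fintype V] [DecidableEq V] [Nonempty V]
    (P : Matrix V V ℝ) (hP0 : ∀ i j, 0 ≤ P i j) (hP1 : ∀ i, ∑ j, P i j = 1)
    (s : V → ℝ) (f : (V → ℝ) → ℝ)
    (hf : ∀ a : V → ℝ,
      f a = ∑ k, ((1 - (1 - diagonal a) * P)⁻¹ *ᵥ (diagonal a *ᵥ s)) k)
    (i : V) (α : V → ℝ) (hα : ∀ j, j ≠ i → α j ∈ Set.Ioo (0 : ℝ) 1) :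
    MonotoneOn (fun x : ℝ => f (Function.update α i x)) (Set.Ioo (0 : ℝ) 1) ∨
      AntitoneOn (fun x : ℝ => f (Function.update α i x)) (Set.Ioo (0 : ℝ) 1) := by
  obtain ⟨z, hz⟩ : ∃ z : ℝ → V → ℝ, ∀ x, z x =
      (1 - (1 - diagonal (Function.update α i x)) * P)⁻¹ *ᵥ
      (diagonal (Function.update α i x) *ᵥ s) := ⟨_, fun _ => rfl⟩
  have hfz : ∀ x, f (Function.update α i x) = ∑ k, z x k := fun x => by rw [hf, hz]
  have hcmp := compare_eq P hP0 hP1 s i α hα z hz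
  obtain ⟨g, hg⟩ : ∃ g : ℝ → ℝ, ∀ x, g x = s i - (P *ᵥ z x) i := ⟨_, fun _ => rfl⟩
  have hF : ∀ x ∈ Set.Ioo (0 : ℝ) 1, ∀ y ∈ Set.Ioo (0 : ℝ) 1, ∃ c : ℝ, 0 ≤ c ∧
      f (Function.update α i y) = f (Function.update α i x) + (y - x) * g x * c := by
    intro x hx y hy
    obtain ⟨w, hw, h⟩ := hcmp x y hx hy
    refine ⟨∑ k, w k, Finset.sum_nonneg fun k _ => hw k, ?_⟩
    rw [hfz, hfz, h, hg, Finset.mul_sum, ← Finset.sum_add_distrib]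
    simp
  have hG : ∀ x ∈ Set.Ioo (0 : ℝ) 1, ∀ y ∈ Set.Ioo (0 : ℝ) 1, y ≤ x →
      ∃ c : ℝ, 0 < c ∧ g y = g x * c := by
    intro x hx y hy hyx
    obtain ⟨w, hw, h⟩ := hcmp x y hx hy
    have hPw : 0 ≤ (P *ᵥ w) i := Finset.sum_nonneg fun j _ => mul_nonneg (hP0 i j) (hw j)
    refine ⟨1 + (x - y) * (P *ᵥ w) i, by nlinarith, ?_⟩
    rw [hg y, h, mulVec_add, mulVec_smul]
    simp only [Pi.add_apply, Pi.smul_apply, smul_eq_mul]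
    rw [← hg x]
    have := hg x
    linear_combination (-1) * this
  by_cases hpos : ∃ x ∈ Set.Ioo (0 : ℝ) 1, 0 < g x
  · left
    obtain ⟨x0, hx0, hgx0⟩ := hpos
    intro x hx y hy hxy
    have hgx : 0 < g x := by
      rcases le_total x x0 with h | h
      · obtain ⟨c, hc, e⟩ := hG x0 hx0 x hx h
        rw [e]; positivity
      · obtain ⟨c, hc, e⟩ := hG x hx x0 hx0 h
        rw [e] at hgx0
        exact pos_of_mul_pos_left hgx0 hc.le
    obtain ⟨c, hc, e⟩ := hF x hx y hy
    have : 0 ≤ (y - x) * g x * c := mul_nonneg (mul_nonneg (by linarith) hgx.le) hc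
    simp only
    linarith
  · right
    push Not at hpos
    intro x hx y hy hxy
    obtain ⟨c, hc, e⟩ := hF x hx y hy
    have : (y - x) * g x * c ≤ 0 :=
      mul_nonpos_of_nonpos_of_nonneg
        (mul_nonpos_of_nonneg_of_nonpos (by linarith) (hpos x hx)) hc
    simp only
    linarith


/-- Corollary (Extreme Points are Sufficient): fixing all coordinates but `i`, the
objective `f` is monotone in `α_i` on `(0,1)` (nondecreasing or nonincreasing);
consequently, in minimizing `f` over a box `Π_i [l_i, u_i]` with `0 < l_i < u_i < 1`,
it suffices to consider vectors whose coordinates are extreme points. -/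
theorem stmt8 {V : Type*} [Fintype V] [DecidableEq V] [Nonempty V]
    (P : Matrix V V ℝ)
    (hP0 : ∀ i j, 0 ≤ P i j) (hP1 : ∀ i, ∑ j, P i j = 1)
    (hPirr : ∀ i j, ∃ t : ℕ, 1 ≤ t ∧ 0 < (P ^ t) i j)
    (s : V → ℝ) (hs : ∀ i, s i ∈ Set.Icc (0 : ℝ) 1)
    (f : (V → ℝ) → ℝ)
    (hf : ∀ a : V → ℝ,
      f a = ∑ k, ((1 - (1 - diagonal a) * P)⁻¹ *ᵥ (diagonal a *ᵥ s)) k) :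
    (∀ (i : V) (α : V → ℝ), (∀ j, j ≠ i → α j ∈ Set.Ioo (0 : ℝ) 1) →
      MonotoneOn (fun x : ℝ => f (Function.update α i x)) (Set.Ioo (0 : ℝ) 1) ∨
      AntitoneOn (fun x : ℝ => f (Function.update α i x)) (Set.Ioo (0 : ℝ) 1)) ∧
    (∀ l u : V → ℝ, (∀ i, 0 < l i ∧ l i < u i ∧ u i < 1) →
      ∀ β : V → ℝ, (∀ i, β i ∈ Set.Icc (l i) (u i)) →
        ∃ γ : V → ℝ, (∀ i, γ i = l i ∨ γ i = u i) ∧ f γ ≤ f β) := by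
  have h1 := part_one P hP0 hP1 s f hf
  refine ⟨h1, ?_⟩
  intro l u hlu β hβ
  have key : ∀ S : Finset V, ∃ γ : V → ℝ, (∀ j, γ j ∈ Set.Icc (l j) (u j)) ∧
      (∀ j ∈ S, γ j = l j ∨ γ j = u j) ∧ f γ ≤ f β := by
    intro S
    induction S using Finset.induction_on with
    | empty => exact ⟨β, hβ, by simp, le_rfl⟩
    | insert i S hi ih =>
      obtain ⟨γ, hγ, hS, hle⟩ := ih
      have hI : ∀ j, ∀ x ∈ Set.Icc (l j) (u j), x ∈ Set.Ioo (0 : ℝ) 1 := fun j x hx =>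
        ⟨(hlu j).1.trans_le hx.1, hx.2.trans_lt (hlu j).2.2⟩
      have hl : l i ∈ Set.Icc (l i) (u i) := ⟨le_rfl, (hlu i).2.1.le⟩
      have hu : u i ∈ Set.Icc (l i) (u i) := ⟨(hlu i).2.1.le, le_rfl⟩
      have fin : ∀ x, (x = l i ∨ x = u i) → f (Function.update γ i x) ≤ f γ →
          ∃ γ : V → ℝ, (∀ j, γ j ∈ Set.Icc (l j) (u j)) ∧
          (∀ j ∈ insert i S, γ j = l j ∨ γ j = u j) ∧ f γ ≤ f β := by
        intro x hx hfx
        refine ⟨Function.update γ i x, fun j => ?_, fun j hj => ?_, hfx.trans hle⟩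
        · by_cases h : j = i
          · subst h
            rw [Function.update_self]
            rcases hx with rfl | rfl
            · exact hl
            · exact hu
          · rw [Function.update_of_ne h]; exact hγ j
        · by_cases h : j = i
          · subst h
            rw [Function.update_self]; exact hx
          · rw [Function.update_of_ne h]
            exact hS j (Finset.mem_of_mem_insert_of_ne hj h)
      rcases h1 i γ (fun j _ => hI j _ (hγ j)) with h | h
      · have := h (hI i _ hl) (hI i _ (hγ i)) (hγ i).1
        simp only [Function.update_eq_self] at this
        exact fin _ (Or.inl rfl) this
      · have := h (hI i _ (hγ i)) (hI i _ hu) (hγ i).2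
        simp only [Function.update_eq_self] at this
        exact fin _ (Or.inr rfl) this
  obtain ⟨γ, _, h, hle⟩ := key Finset.univ
  exact ⟨γ, fun j => h j (Finset.mem_univ j), hle⟩
end

section
/- (Local implies global optimum) Let P be an irreducible row-stochastic matrix on a set V with |V| ≥ 3, s ∈ [0,1]^V, and f(α) = 1ᵀ [I − (I − A)P]^{−1} A s. Let I_V = Π_{i∈V}[l_i, u_i] be a box with 0 < l_i < u_i < 1 for each i. If α ∈ I_V is a local minimizer of f on I_V, meaning that f(α) ≤ f(α') for every α' ∈ I_V differing from α in exactly one coordinate, then α is a global minimizer: f(α) ≤ f(β) for every β ∈ I_V. -/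
open Matrix

theorem aux_pos {V : Type*} [Fintype V] [DecidableEq V]
    (P : Matrix V V ℝ) (hP0 : ∀ i j, 0 ≤ P i j) (hP1 : ∀ i, ∑ j, P i j = 1)
    (a : V → ℝ) (ha : ∀ i, 0 < a i ∧ a i < 1) (x : V → ℝ)
    (hx : ∀ i, (1 - a i) * (P *ᵥ x) i ≤ x i) : ∀ i, 0 ≤ x i := by
  intro k
  haveI : Nonempty V := ⟨k⟩
  obtain ⟨m, hm⟩ := Finite.exists_min x
  have h1 : x m ≤ (P *ᵥ x) m := by
    calc x m = ∑ j, P m j * x m := by rw [← Finset.sum_mul, hP1, one_mul]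
      _ ≤ ∑ j, P m j * x j :=
        Finset.sum_le_sum fun j _ => mul_le_mul_of_nonneg_left (hm j) (hP0 m j)
  have h2 := hx m
  have h3 := mul_le_mul_of_nonneg_left h1 (sub_pos.2 (ha m).2).le
  have h4 : 0 ≤ a m * x m := by linarith
  exact (nonneg_of_mul_nonneg_right h4 (ha m).1).trans (hm k)

theorem aux_mulVec {V : Type*} [Fintype V] [DecidableEq V]
    (P : Matrix V V ℝ) (a x : V → ℝ) (i : V) :
    ((1 - (1 - diagonal a) * P) *ᵥ x) i = x i - (1 - a i) * (P *ᵥ x) i := by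
  rw [sub_mulVec, one_mulVec, ← mulVec_mulVec, sub_mulVec, one_mulVec]
  simp only [Pi.sub_apply, mulVec_diagonal]
  ring

theorem aux_fix {V : Type*} [Fintype V] [DecidableEq V]
    (P : Matrix V V ℝ) (hP0 : ∀ i j, 0 ≤ P i j) (hP1 : ∀ i, ∑ j, P i j = 1)
    (s : V → ℝ) (a : V → ℝ) (ha : ∀ i, 0 < a i ∧ a i < 1) (i : V) :
    let z := (1 - (1 - diagonal a) * P)⁻¹ *ᵥ (diagonal a *ᵥ s)
    z i = a i * s i + (1 - a i) * (P *ᵥ z) i := by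
  intro z
  have hu : IsUnit (1 - (1 - diagonal a) * P) := by
    rw [← mulVec_injective_iff_isUnit]
    intro x y hxy
    have key : ∀ x y : V → ℝ, (1 - (1 - diagonal a) * P) *ᵥ x = (1 - (1 - diagonal a) * P) *ᵥ y →
        ∀ i, 0 ≤ (x - y) i := by
      intro x y hxy
      apply aux_pos P hP0 hP1 a ha
      intro i
      have h := aux_mulVec P a (x - y) i
      rw [mulVec_sub, hxy, sub_self, Pi.zero_apply] at h
      linarith
    funext i
    have h1 := key x y hxy i
    have h2 := key y x hxy.symm i
    simp only [Pi.sub_apply] at h1 h2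
    linarith
  have h : (1 - (1 - diagonal a) * P) *ᵥ z = diagonal a *ᵥ s := by
    simp only [z]
    rw [mulVec_mulVec, mul_nonsing_inv _ ((isUnit_iff_isUnit_det _).1 hu), one_mulVec]
  have h1 := congrFun h i
  rw [aux_mulVec, mulVec_diagonal] at h1
  linarith

/-- Corollary (Local implies global optimum): if `α` in the box `Π_i [l_i, u_i]`
(with `0 < l_i < u_i < 1`) satisfies `f(α) ≤ f(α')` for every `α'` in the box that
differs from `α` in exactly one coordinate, then `f(α) ≤ f(β)` for every `β` in the box. -/
theorem stmt13 {V : Type*} [Fintype V] [DecidableEq V]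
    (hcard : 3 ≤ Fintype.card V)
    (P : Matrix V V ℝ)
    (hP0 : ∀ i j, 0 ≤ P i j) (hP1 : ∀ i, ∑ j, P i j = 1)
    (hPirr : ∀ i j, ∃ t : ℕ, 1 ≤ t ∧ 0 < (P ^ t) i j)
    (s : V → ℝ) (hs : ∀ i, s i ∈ Set.Icc (0 : ℝ) 1)
    (f : (V → ℝ) → ℝ)
    (hf : ∀ a : V → ℝ,
      f a = ∑ j, ((1 - (1 - diagonal a) * P)⁻¹ *ᵥ (diagonal a *ᵥ s)) j)
    (l u : V → ℝ) (hlu : ∀ i, 0 < l i ∧ l i < u i ∧ u i < 1)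
    (α : V → ℝ) (hαbox : ∀ i, α i ∈ Set.Icc (l i) (u i))
    (hloc : ∀ α' : V → ℝ, (∀ j, α' j ∈ Set.Icc (l j) (u j)) →
      (∃ i, α' i ≠ α i ∧ ∀ j, j ≠ i → α' j = α j) → f α ≤ f α') :
    ∀ β : V → ℝ, (∀ j, β j ∈ Set.Icc (l j) (u j)) → f α ≤ f β := by
  have hin : ∀ b : V → ℝ, (∀ j, b j ∈ Set.Icc (l j) (u j)) → ∀ i, 0 < b i ∧ b i < 1 :=
    fun b hb i => ⟨(hlu i).1.trans_le (hb i).1, (hb i).2.trans_lt (hlu i).2.2⟩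
  have hfix : ∀ b : V → ℝ, (∀ j, b j ∈ Set.Icc (l j) (u j)) →
      ∃ z : V → ℝ, f b = ∑ j, z j ∧ ∀ i, z i = b i * s i + (1 - b i) * (P *ᵥ z) i :=
    fun b hb => ⟨_, hf b, fun i => aux_fix P hP0 hP1 s b (hin b hb) i⟩
  obtain ⟨z, hz, hz'⟩ := hfix α hαbox
  -- sign condition on the gradient from coordinatewise optimality
  have hsign : ∀ i, ∀ t ∈ Set.Icc (l i) (u i), 0 ≤ (t - α i) * (s i - (P *ᵥ z) i) := by
    intro i t ht
    by_cases hti : t = α i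
    · simp [hti]
    by_contra hneg
    push Not at hneg
    set b := Function.update α i t with hb
    have hbi : b i = t := by simp [hb]
    have hbj : ∀ j, j ≠ i → b j = α j := fun j hj => by simp [hb, hj]
    have hbbox : ∀ j, b j ∈ Set.Icc (l j) (u j) := by
      intro j
      by_cases hj : j = i
      · subst hj; rw [hbi]; exact ht
      · rw [hbj j hj]; exact hαbox j
    have hle := hloc b hbbox ⟨i, by rw [hbi]; exact hti, hbj⟩
    obtain ⟨w, hw, hw'⟩ := hfix b hbbox
    have hPs : ∀ j, (P *ᵥ (z - w)) j = (P *ᵥ z) j - (P *ᵥ w) j := fun j => by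
      rw [mulVec_sub, Pi.sub_apply]
    have hpos : ∀ j, 0 ≤ (z - w) j := by
      apply aux_pos P hP0 hP1 b (hin b hbbox)
      intro j
      rw [hPs, Pi.sub_apply]
      by_cases hj : j = i
      · subst hj
        have h1 := hz' j
        have h2 := hw' j
        rw [hbi] at h2 ⊢
        nlinarith
      · have h1 := hz' j
        have h2 := hw' j
        rw [hbj j hj] at h2 ⊢
        nlinarith
    have hstrict : w i < z i := by
      have h0 : 0 ≤ (P *ᵥ (z - w)) i :=
        Finset.sum_nonneg fun j _ => mul_nonneg (hP0 i j) (hpos j)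
      rw [hPs] at h0
      have h1 := hz' i
      have h2 := hw' i
      have h3 := mul_nonneg (sub_pos.2 (hin b hbbox i).2).le h0
      rw [hbi] at h2 h3
      nlinarith
    have : ∑ j, w j < ∑ j, z j :=
      Finset.sum_lt_sum (fun j _ => by have := hpos j; simp only [Pi.sub_apply] at this; linarith)
        ⟨i, Finset.mem_univ i, hstrict⟩
    linarith
  intro β hβ
  obtain ⟨w, hw, hw'⟩ := hfix β hβ
  have hpos : ∀ j, 0 ≤ (w - z) j := by
    apply aux_pos P hP0 hP1 β (hin β hβ)
    intro j
    rw [mulVec_sub, Pi.sub_apply, Pi.sub_apply]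
    have h1 := hz' j
    have h2 := hw' j
    have h3 := hsign j (β j) (hβ j)
    nlinarith
  rw [hz, hw]
  exact Finset.sum_le_sum fun j _ => by
    have := hpos j
    simp only [Pi.sub_apply] at this
    linarith
end
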